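/- arXiv:1303.1769 — 5 statements merged into one kernel-verified Lean document; each statement's English description precedes it below -/
import Mathlib

section
/- For every 0 < ε < 1 and all Schwartz functions φ, ψ : ℝ → ℝ, the operator Λ^{1−ε} is L²-symmetric: ∫_ℝ ψ(x) Λ^{1−ε}φ(x) dx = ∫_ℝ φ(x) Λ^{1−ε}ψ(x) dx. -/
open MeasureTheory Real Filter Topology Set

/-- Principal value integral over `ℝ` with singularity at the origin:
`I = p.v.∫_ℝ F(η) dη = lim_{δ → 0⁺} ∫_{δ < |η|} F(η) dη`. -/
def HasPV (F : ℝ → ℝ) (I : ℝ) : Prop :=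
  Tendsto (fun δ : ℝ => ∫ η in {η : ℝ | δ < |η|}, F η) (𝓝[>] 0) (𝓝 I)

/-- Principal value integral over `ℝ` with singularity at the point `c`. -/
def HasPVat (c : ℝ) (F : ℝ → ℝ) (I : ℝ) : Prop :=
  Tendsto (fun δ : ℝ => ∫ η in {η : ℝ | δ < |η - c|}, F η) (𝓝[>] 0) (𝓝 I)

/-- The finite-depth operator `Λ^{1-ε}` (depth normalized to `l = π/2`), defined as a
principal value:  `Λ^{1-ε}φ(x) = p.v.∫_ℝ (φ(x) - φ(x-η)) |tanh(η/2)|^ε / sinh²(η/2) dη`.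
The case `ε = 0` is the operator `Λ`. -/
noncomputable def Lam (ε : ℝ) (φ : ℝ → ℝ) (x : ℝ) : ℝ :=
  limUnder (𝓝[>] (0:ℝ))
    (fun δ : ℝ => ∫ η in {η : ℝ | δ < |η|},
      (φ x - φ (x - η)) * |Real.tanh (η / 2)| ^ ε / Real.sinh (η / 2) ^ 2)

/-- The kernel `|tanh(η/2)|^ε / sinh²(η/2)` of `Λ^{1-ε}`. -/
noncomputable def lamKernel (ε η : ℝ) : ℝ :=
  |Real.tanh (η / 2)| ^ ε / Real.sinh (η / 2) ^ 2

/-- The symmetric second difference `2f(x) - f(x-η) - f(x+η)`. -/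
def secondDiff (f : ℝ → ℝ) (x η : ℝ) : ℝ :=
  2 * f x - f (x - η) - f (x + η)

lemma lamKernel_neg (ε η : ℝ) : lamKernel ε (-η) = lamKernel ε η := by
  simp [lamKernel, neg_div, Real.tanh_neg, Real.sinh_neg]

lemma lamKernel_nonneg (ε η : ℝ) : 0 ≤ lamKernel ε η := by
  unfold lamKernel; positivity

lemma measurable_lamKernel (ε : ℝ) : Measurable (lamKernel ε) := by
  unfold lamKernel
  simp only [Real.tanh_eq_sinh_div_cosh]
  fun_prop

lemma sq_mul_one_add_sq_le_sinh_sq (t : ℝ) :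
    t ^ 2 * (1 + (t / 2) ^ 2) ≤ Real.sinh t ^ 2 := by
  have key (u : ℝ) : u ^ 2 ≤ Real.sinh u ^ 2 := by
    rw [sq_le_sq, Real.abs_sinh]
    exact Real.self_le_sinh_iff.2 (abs_nonneg u)
  have h1 := key (t / 2)
  have h2 : Real.sinh t = 2 * Real.sinh (t / 2) * Real.cosh (t / 2) := by
    rw [← Real.sinh_two_mul]; congr 1; ring
  rw [h2, mul_pow, mul_pow, Real.cosh_sq']
  calc t ^ 2 * (1 + (t / 2) ^ 2) = 2 ^ 2 * (t / 2) ^ 2 * (1 + (t / 2) ^ 2) := by ring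
    _ ≤ _ := by gcongr

lemma sq_mul_lamKernel_le {ε : ℝ} (hε : 0 ≤ ε) (η : ℝ) :
    η ^ 2 * lamKernel ε η ≤ 4 * (1 + (η / 4) ^ 2)⁻¹ := by
  rcases eq_or_ne η 0 with rfl | hη
  · simp
  have hs := sq_mul_one_add_sq_le_sinh_sq (η / 2)
  have hη2 : 0 < η ^ 2 := by positivity
  have hpos : 0 < Real.sinh (η / 2) ^ 2 := lt_of_lt_of_le (by positivity) hs
  have ht : |Real.tanh (η / 2)| ^ ε ≤ 1 :=
    Real.rpow_le_one (abs_nonneg _) (Real.abs_tanh_lt_one _).le hε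
  unfold lamKernel
  rw [← mul_div_assoc, ← div_eq_mul_inv, div_le_div_iff₀ hpos (by positivity)]
  calc η ^ 2 * |Real.tanh (η / 2)| ^ ε * (1 + (η / 4) ^ 2)
      ≤ η ^ 2 * 1 * (1 + (η / 4) ^ 2) := by gcongr
    _ = 4 * ((η / 2) ^ 2 * (1 + (η / 2 / 2) ^ 2)) := by ring
    _ ≤ _ := by gcongr

lemma integrable_inv_one_add_div_sq {c : ℝ} (hc : c ≠ 0) :
    Integrable fun η : ℝ => (1 + (η / c) ^ 2)⁻¹ :=
  integrable_inv_one_add_sq.comp_div hc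

lemma SchwartzMap.exists_abs_le (f : SchwartzMap ℝ ℝ) : ∃ C, 0 ≤ C ∧ ∀ x, |f x| ≤ C := by
  obtain ⟨C, hC⟩ := f.decay 0 0
  refine ⟨C, hC.1.le, fun x => ?_⟩
  simpa using hC.2 x

lemma SchwartzMap.exists_abs_secondDiff_le (f : SchwartzMap ℝ ℝ) :
    ∃ C, 0 ≤ C ∧ ∀ x η, |secondDiff f x η| ≤ C * η ^ 2 := by
  obtain ⟨M, hM0, hM⟩ := (SchwartzMap.derivCLM ℝ ℝ (SchwartzMap.derivCLM ℝ ℝ f)).exists_abs_le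
  have hf (x : ℝ) : HasDerivAt f (SchwartzMap.derivCLM ℝ ℝ f x) x := by
    simpa using f.differentiableAt.hasDerivAt
  have hf' (x : ℝ) : HasDerivAt (SchwartzMap.derivCLM ℝ ℝ f)
      (SchwartzMap.derivCLM ℝ ℝ (SchwartzMap.derivCLM ℝ ℝ f) x) x := by
    simpa using (SchwartzMap.derivCLM ℝ ℝ f).differentiableAt.hasDerivAt
  have hlip (a b : ℝ) :
      |SchwartzMap.derivCLM ℝ ℝ f b - SchwartzMap.derivCLM ℝ ℝ f a| ≤ M * |b - a| :=
    convex_univ.norm_image_sub_le_of_norm_hasDerivWithin_le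
      (fun x _ => (hf' x).hasDerivWithinAt) (fun x _ => hM x) (mem_univ a) (mem_univ b)
  refine ⟨2 * M, by positivity, fun x η => ?_⟩
  have hd (t : ℝ) : HasDerivAt (secondDiff f x)
      (SchwartzMap.derivCLM ℝ ℝ f (x - t) - SchwartzMap.derivCLM ℝ ℝ f (x + t)) t := by
    have h1 := (hf (x - t)).comp_const_sub x t
    have h2 := (hf (x + t)).comp_const_add x t
    exact ((h1.const_sub (2 * f x)).sub h2).congr_deriv (by ring)
  have hb : ∀ t ∈ uIcc 0 η,
      ‖SchwartzMap.derivCLM ℝ ℝ f (x - t) - SchwartzMap.derivCLM ℝ ℝ f (x + t)‖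
        ≤ 2 * M * |η| := by
    intro t ht
    have htη : |t| ≤ |η| := by simpa using abs_sub_left_of_mem_uIcc ht
    calc _ ≤ M * |x - t - (x + t)| := hlip _ _
      _ = 2 * M * |t| := by
        rw [show x - t - (x + t) = -(2 * t) by ring, abs_neg, abs_mul, abs_two]; ring
      _ ≤ _ := by gcongr
  have h := (convex_uIcc 0 η).norm_image_sub_le_of_norm_hasDerivWithin_le
    (fun t _ => (hd t).hasDerivWithinAt) hb left_mem_uIcc right_mem_uIcc
  have h0 : secondDiff f x 0 = 0 := by simp [secondDiff]; ring
  rw [h0, sub_zero, sub_zero, Real.norm_eq_abs, Real.norm_eq_abs, mul_assoc,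
    abs_mul_abs_self] at h
  rwa [sq]

lemma SchwartzMap.exists_abs_secondDiff_mul_lamKernel_le {ε : ℝ} (hε : 0 ≤ ε)
    (f : SchwartzMap ℝ ℝ) :
    ∃ C, 0 ≤ C ∧ ∀ x η, |secondDiff f x η * lamKernel ε η| ≤ C * (1 + (η / 4) ^ 2)⁻¹ := by
  obtain ⟨C, hC0, hC⟩ := f.exists_abs_secondDiff_le
  refine ⟨C * 4, by positivity, fun x η => ?_⟩
  rw [abs_mul, abs_of_nonneg (lamKernel_nonneg ε η)]
  calc _ ≤ C * η ^ 2 * lamKernel ε η :=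
        mul_le_mul_of_nonneg_right (hC x η) (lamKernel_nonneg ε η)
    _ = C * (η ^ 2 * lamKernel ε η) := by ring
    _ ≤ C * (4 * (1 + (η / 4) ^ 2)⁻¹) :=
        mul_le_mul_of_nonneg_left (sq_mul_lamKernel_le hε η) hC0
    _ = _ := by ring

lemma SchwartzMap.integrable_secondDiff_mul_lamKernel {ε : ℝ} (hε : 0 ≤ ε)
    (f : SchwartzMap ℝ ℝ) (x : ℝ) :
    Integrable fun η => secondDiff f x η * lamKernel ε η := by
  obtain ⟨C, -, hC⟩ := f.exists_abs_secondDiff_mul_lamKernel_le hε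
  refine ((integrable_inv_one_add_div_sq four_ne_zero).const_mul C).mono' ?_
    (ae_of_all _ (hC x))
  have := f.continuous
  have := measurable_lamKernel ε
  refine (Measurable.mul ?_ this).aestronglyMeasurable
  unfold secondDiff
  fun_prop

lemma measurableSet_lt_abs (δ : ℝ) : MeasurableSet {η : ℝ | δ < |η|} :=
  measurableSet_lt measurable_const measurable_id.abs

lemma SchwartzMap.integrableOn_sub_mul_lamKernel {ε : ℝ} (hε : 0 ≤ ε)
    (f : SchwartzMap ℝ ℝ) (x : ℝ) {δ : ℝ} (hδ : 0 < δ) :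
    IntegrableOn (fun η => (f x - f (x - η)) * lamKernel ε η) {η : ℝ | δ < |η|} := by
  obtain ⟨C, hC0, hC⟩ := f.exists_abs_le
  refine (((integrable_inv_one_add_div_sq four_ne_zero).const_mul
    (2 * C * (4 / δ ^ 2))).integrableOn (s := {η : ℝ | δ < |η|})).mono' ?_ ?_
  · have := f.continuous
    refine (Measurable.mul ?_ (measurable_lamKernel ε)).aestronglyMeasurable
    fun_prop
  · refine (ae_restrict_iff' (measurableSet_lt_abs δ)).2 (ae_of_all _ fun η hη => ?_)
    have hη : δ < |η| := hη
    have hk : lamKernel ε η ≤ 4 / δ ^ 2 * (1 + (η / 4) ^ 2)⁻¹ := by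
      rw [div_mul_eq_mul_div, le_div_iff₀ (by positivity), mul_comm]
      refine le_trans ?_ (sq_mul_lamKernel_le hε η)
      refine mul_le_mul_of_nonneg_right ?_ (lamKernel_nonneg ε η)
      rw [← sq_abs η]
      gcongr
    have hd : |f x - f (x - η)| ≤ 2 * C := by
      linarith [abs_sub (f x) (f (x - η)), hC x, hC (x - η)]
    rw [Real.norm_eq_abs, abs_mul, abs_of_nonneg (lamKernel_nonneg ε η), mul_assoc]
    exact mul_le_mul hd hk (lamKernel_nonneg ε η) (by positivity)

lemma SchwartzMap.setIntegral_sub_mul_lamKernel {ε : ℝ} (hε : 0 ≤ ε)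
    (f : SchwartzMap ℝ ℝ) (x : ℝ) {δ : ℝ} (hδ : 0 < δ) :
    ∫ η in {η : ℝ | δ < |η|}, (f x - f (x - η)) * lamKernel ε η =
      (∫ η in {η : ℝ | δ < |η|}, secondDiff f x η * lamKernel ε η) / 2 := by
  have hi := f.integrableOn_sub_mul_lamKernel hε x hδ
  have hpre : Neg.neg ⁻¹' {η : ℝ | δ < |η|} = {η : ℝ | δ < |η|} := by
    ext η; simp
  have hmp := Measure.measurePreserving_neg (volume : Measure ℝ)
  have hemb := (MeasurableEquiv.neg ℝ).measurableEmbedding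
  have hi' := (hmp.integrableOn_comp_preimage hemb).2 hi
  have he := hmp.setIntegral_preimage_emb hemb
    (fun η => (f x - f (x - η)) * lamKernel ε η) {η : ℝ | δ < |η|}
  rw [hpre] at hi' he
  replace hi' : IntegrableOn (fun η => (f x - f (x - -η)) * lamKernel ε (-η))
    {η : ℝ | δ < |η|} := hi'
  have hsum : ∀ η, secondDiff f x η * lamKernel ε η =
      (f x - f (x - η)) * lamKernel ε η + (f x - f (x - -η)) * lamKernel ε (-η) := by
    intro η
    rw [lamKernel_neg, sub_neg_eq_add]
    unfold secondDiff
    ring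
  simp_rw [hsum]
  rw [integral_add hi hi', he]
  ring

lemma SchwartzMap.tendsto_setIntegral_sub_mul_lamKernel {ε : ℝ} (hε : 0 ≤ ε)
    (f : SchwartzMap ℝ ℝ) (x : ℝ) :
    Tendsto (fun δ : ℝ => ∫ η in {η : ℝ | δ < |η|}, (f x - f (x - η)) * lamKernel ε η)
      (𝓝[>] 0) (𝓝 ((∫ η, secondDiff f x η * lamKernel ε η) / 2)) := by
  have hi := f.integrable_secondDiff_mul_lamKernel hε x
  have hlim : Tendsto (fun δ : ℝ => ∫ η, {η : ℝ | δ < |η|}.indicator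
      (fun η => secondDiff f x η * lamKernel ε η) η)
      (𝓝[>] 0) (𝓝 (∫ η, secondDiff f x η * lamKernel ε η)) := by
    refine tendsto_integral_filter_of_dominated_convergence _
      (Eventually.of_forall fun δ => (hi.indicator (measurableSet_lt_abs δ)).1)
      (Eventually.of_forall fun δ => ae_of_all _ fun η => norm_indicator_le_norm_self _ _)
      hi.norm ?_
    filter_upwards [Measure.ae_ne volume (0 : ℝ)] with η hη
    refine tendsto_const_nhds.congr' ?_
    filter_upwards [Ioo_mem_nhdsGT (show (0 : ℝ) < |η| from abs_pos.2 hη)] with δ hδ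
    rw [indicator_of_mem (show η ∈ {η : ℝ | δ < |η|} from hδ.2)]
  refine (hlim.div_const 2).congr' ?_
  filter_upwards [self_mem_nhdsWithin] with δ hδ
  rw [f.setIntegral_sub_mul_lamKernel hε x hδ, integral_indicator (measurableSet_lt_abs δ)]

lemma SchwartzMap.lam_eq {ε : ℝ} (hε : 0 ≤ ε) (f : SchwartzMap ℝ ℝ) (x : ℝ) :
    Lam ε f x = (∫ η, secondDiff f x η * lamKernel ε η) / 2 := by
  have h := f.tendsto_setIntegral_sub_mul_lamKernel hε x
  simp only [lamKernel, ← mul_div_assoc] at h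
  simpa only [Lam, lamKernel, ← mul_div_assoc] using h.limUnder_eq

lemma SchwartzMap.hasPV_lam {ε : ℝ} (hε : 0 ≤ ε) (f : SchwartzMap ℝ ℝ) (x : ℝ) :
    HasPV (fun η => (f x - f (x - η)) * |Real.tanh (η / 2)| ^ ε / Real.sinh (η / 2) ^ 2)
      (Lam ε f x) := by
  rw [f.lam_eq hε]
  simpa only [HasPV, lamKernel, ← mul_div_assoc] using
    f.tendsto_setIntegral_sub_mul_lamKernel hε x

lemma SchwartzMap.integrable_mul_comp_add (f g : SchwartzMap ℝ ℝ) (a : ℝ) :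
    Integrable fun x => f x * g (x + a) := by
  obtain ⟨C, -, hC⟩ := g.exists_abs_le
  have := g.continuous
  exact f.integrable.mul_bdd (c := C) (by fun_prop) (ae_of_all _ fun x => hC _)

lemma SchwartzMap.integral_mul_secondDiff (f g : SchwartzMap ℝ ℝ) (η : ℝ) :
    ∫ x, g x * secondDiff f x η = ∫ x, f x * secondDiff g x η := by
  have expand (f g : SchwartzMap ℝ ℝ) : ∫ x, g x * secondDiff f x η =
      2 * (∫ x, g x * f x) - (∫ x, g x * f (x + -η)) - ∫ x, g x * f (x + η) := by
    have h0 := g.integrable_mul_comp_add f 0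
    simp only [add_zero] at h0
    have h1 := g.integrable_mul_comp_add f (-η)
    have h2 := g.integrable_mul_comp_add f η
    have h01 : Integrable fun x => 2 * (g x * f x) - g x * f (x + -η) := (h0.const_mul 2).sub h1
    rw [← integral_const_mul, ← integral_sub (h0.const_mul 2) h1, ← integral_sub h01 h2]
    congr 1 with x
    simp only [secondDiff, ← sub_eq_add_neg]
    ring
  have shift (f g : SchwartzMap ℝ ℝ) (a : ℝ) :
      ∫ x, g x * f (x + a) = ∫ x, f x * g (x + -a) := by
    rw [← integral_add_right_eq_self (fun x => f x * g (x + -a)) a]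
    congr 1 with x
    rw [add_neg_cancel_right, mul_comm]
  rw [expand f g, expand g f, shift f g η, shift f g (-η), neg_neg]
  simp_rw [mul_comm (g _) (f _)]
  ring

lemma SchwartzMap.integral_mul_lam {ε : ℝ} (hε : 0 ≤ ε) (f g : SchwartzMap ℝ ℝ) :
    ∫ x, g x * Lam ε f x = (∫ η, (∫ x, g x * secondDiff f x η) * lamKernel ε η) / 2 := by
  have hint : Integrable
      (Function.uncurry fun x η => g x * (secondDiff f x η * lamKernel ε η))
      (volume.prod volume) := by
    obtain ⟨C, hC0, hC⟩ := f.exists_abs_secondDiff_mul_lamKernel_le hε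
    refine (g.integrable.norm.mul_prod
      ((integrable_inv_one_add_div_sq four_ne_zero).const_mul C)).mono' ?_
      (ae_of_all _ fun p => ?_)
    · have hf := f.continuous.measurable
      have hg := g.continuous.measurable
      have hk := measurable_lamKernel ε
      unfold Function.uncurry secondDiff
      exact Measurable.aestronglyMeasurable (by fun_prop)
    · simp only [Function.uncurry, norm_mul (g p.1)]
      exact mul_le_mul_of_nonneg_left (hC _ _) (norm_nonneg _)
  simp_rw [f.lam_eq hε, ← mul_div_assoc, integral_div, ← integral_const_mul]
  rw [integral_integral_swap hint]
  simp_rw [← mul_assoc, integral_mul_const]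

/-- For every `0 < ε < 1` and all Schwartz functions `φ, ψ : ℝ → ℝ`,
the principal values defining `Λ^{1-ε}φ` and `Λ^{1-ε}ψ` exist at every point and the
operator `Λ^{1-ε}` is `L²`-symmetric:
`∫ ψ(x) Λ^{1-ε}φ(x) dx = ∫ φ(x) Λ^{1-ε}ψ(x) dx`. -/
theorem lam_L2_symmetric (ε : ℝ) (hε : 0 < ε) (hε1 : ε < 1) (φ ψ : SchwartzMap ℝ ℝ) :
    (∀ x : ℝ, HasPV
      (fun η => (φ x - φ (x - η)) * |Real.tanh (η / 2)| ^ ε / Real.sinh (η / 2) ^ 2)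
      (Lam ε (⇑φ) x)) ∧
    (∀ x : ℝ, HasPV
      (fun η => (ψ x - ψ (x - η)) * |Real.tanh (η / 2)| ^ ε / Real.sinh (η / 2) ^ 2)
      (Lam ε (⇑ψ) x)) ∧
    (∫ x : ℝ, ψ x * Lam ε (⇑φ) x) = ∫ x : ℝ, φ x * Lam ε (⇑ψ) x := by
  refine ⟨φ.hasPV_lam hε.le, ψ.hasPV_lam hε.le, ?_⟩
  rw [φ.integral_mul_lam hε.le ψ, ψ.integral_mul_lam hε.le φ]
  simp_rw [φ.integral_mul_secondDiff ψ]
end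

section
/- For every 0 < ε < 1 and every Schwartz function φ : ℝ → ℝ, the operator Λ^{1−ε} is positive definite: ∫_ℝ φ(x) Λ^{1−ε}φ(x) dx = (1/2) ∫_ℝ ∫_ℝ (φ(x) − φ(x−η))² |tanh(η/2)|^ε / sinh²(η/2) dη dx ≥ 0. -/
open MeasureTheory Real Filter Topology Set

lemma lamKernel_le {ε : ℝ} (hε : 0 ≤ ε) (hε2 : ε ≤ 2) {η : ℝ} (hη : 0 < η) :
    lamKernel ε η ≤ (η / 2) ^ (ε - 2) := by
  have ht : 0 < η / 2 := by positivity
  have hs : η / 2 ≤ Real.sinh (η / 2) := Real.self_le_sinh_iff.2 ht.le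
  have hs0 : 0 < Real.sinh (η / 2) := ht.trans_le hs
  have htanh : |Real.tanh (η / 2)| ≤ Real.sinh (η / 2) := by
    rw [Real.tanh_eq_sinh_div_cosh, abs_of_nonneg (by positivity)]
    exact div_le_self hs0.le (Real.one_le_cosh _)
  calc lamKernel ε η ≤ Real.sinh (η / 2) ^ ε / Real.sinh (η / 2) ^ 2 := by
        unfold lamKernel
        gcongr
    _ = Real.sinh (η / 2) ^ (ε - 2) := by
        rw [Real.rpow_sub hs0, Real.rpow_two]
    _ ≤ (η / 2) ^ (ε - 2) :=
        Real.rpow_le_rpow_of_nonpos ht hs (by linarith)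

lemma integrable_min_mul_lamKernel {ε : ℝ} (hε : 0 < ε) (hε1 : ε < 1) :
    Integrable fun η : ℝ => min 1 |η| * lamKernel ε η := by
  have hmeas : Measurable fun η : ℝ => min 1 |η| * lamKernel ε η :=
    (measurable_const.min _root_.continuous_abs.measurable).mul (measurable_lamKernel ε)
  have hnorm (η : ℝ) : ‖min 1 |η| * lamKernel ε η‖ = min 1 |η| * lamKernel ε η := by
    rw [Real.norm_of_nonneg]
    exact mul_nonneg (by positivity) (lamKernel_nonneg _ _)
  have hsmall : IntegrableOn (fun η : ℝ => min 1 |η| * lamKernel ε η) (Ioc 0 1) := by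
    have hint : IntegrableOn (fun η : ℝ => (2 : ℝ) ^ (2 - ε) * η ^ (ε - 1)) (Ioc 0 1) := by
      refine Integrable.const_mul ?_ _
      exact (intervalIntegrable_iff_integrableOn_Ioc_of_le zero_le_one).1
        (intervalIntegral.intervalIntegrable_rpow' (by linarith))
    refine hint.mono' hmeas.aestronglyMeasurable ?_
    filter_upwards [ae_restrict_mem measurableSet_Ioc] with η hη
    rw [hnorm]
    calc min 1 |η| * lamKernel ε η ≤ η * (η / 2) ^ (ε - 2) := by
          refine mul_le_mul ?_ (lamKernel_le hε.le (by linarith) hη.1)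
            (lamKernel_nonneg _ _) hη.1.le
          exact (min_le_right _ _).trans_eq (abs_of_pos hη.1)
      _ = (2 : ℝ) ^ (2 - ε) * η ^ (ε - 1) := by
          rw [Real.div_rpow hη.1.le zero_le_two, show ε - 1 = (ε - 2) + 1 by ring,
            Real.rpow_add_one hη.1.ne', show 2 - ε = -(ε - 2) by ring,
            Real.rpow_neg zero_le_two]
          ring
  have hlarge : IntegrableOn (fun η : ℝ => min 1 |η| * lamKernel ε η) (Ioi 1) := by
    have hint : IntegrableOn (fun η : ℝ => (2 : ℝ) ^ (2 - ε) * η ^ (ε - 2)) (Ioi 1) :=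
      Integrable.const_mul (integrableOn_Ioi_rpow_of_lt (by linarith) zero_lt_one) _
    refine hint.mono' hmeas.aestronglyMeasurable ?_
    filter_upwards [ae_restrict_mem measurableSet_Ioi] with η hη
    have hη0 : 0 < η := zero_lt_one.trans hη
    rw [hnorm]
    calc min 1 |η| * lamKernel ε η ≤ 1 * (η / 2) ^ (ε - 2) :=
          mul_le_mul (min_le_left _ _) (lamKernel_le hε.le (by linarith) hη0)
            (lamKernel_nonneg _ _) zero_le_one
      _ = (2 : ℝ) ^ (2 - ε) * η ^ (ε - 2) := by
          rw [Real.div_rpow hη0.le zero_le_two, show 2 - ε = -(ε - 2) by ring,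
            Real.rpow_neg zero_le_two]
          ring
  have hpos : IntegrableOn (fun η : ℝ => min 1 |η| * lamKernel ε η) (Ioi 0) := by
    rw [← Ioc_union_Ioi_eq_Ioi zero_le_one]
    exact hsmall.union hlarge
  have hneg : IntegrableOn (fun η : ℝ => min 1 |η| * lamKernel ε η) (Iic 0) := by
    rw [integrableOn_Iic_iff_integrableOn_Iio]
    have h := hpos
    rw [← neg_zero] at h
    simpa [lamKernel_neg] using h.comp_neg_Iio
  rw [← integrableOn_univ, ← Iic_union_Ioi (a := (0 : ℝ))]
  exact hneg.union hpos

lemma SchwartzMap.exists_abs_sub_le_min (φ : SchwartzMap ℝ ℝ) :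
    ∃ C : ℝ, 0 ≤ C ∧ ∀ x η : ℝ, |φ x - φ (x - η)| ≤ C * min 1 |η| := by
  obtain ⟨M, hM⟩ : ∃ M : ℝ, ∀ x, |φ x| ≤ M := by
    obtain ⟨M, hM⟩ := φ.decay 0 0
    exact ⟨M, fun x => by simpa using hM.2 x⟩
  obtain ⟨L, hL⟩ : ∃ L : ℝ, ∀ x, ‖deriv φ x‖ ≤ L := by
    obtain ⟨L, hL⟩ := φ.decay 0 1
    refine ⟨L, fun x => ?_⟩
    have := hL.2 x
    rwa [pow_zero, one_mul, norm_iteratedFDeriv_eq_norm_iteratedDeriv, iteratedDeriv_one] at this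
  have hM0 : 0 ≤ M := (abs_nonneg _).trans (hM 0)
  refine ⟨max (2 * M) L, le_max_of_le_left (by positivity), fun x η => ?_⟩
  rcases le_total 1 |η| with h | h
  · rw [min_eq_left h, mul_one]
    refine le_max_of_le_left ?_
    calc |φ x - φ (x - η)| ≤ |φ x| + |φ (x - η)| := abs_sub _ _
      _ ≤ 2 * M := by linarith [hM x, hM (x - η)]
  · rw [min_eq_right h]
    have := Convex.norm_image_sub_le_of_norm_deriv_le (f := φ) (s := univ) (C := L)
      (x := x - η) (y := x) (fun y _ => φ.differentiableAt) (fun y _ => hL y) convex_univ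
      (mem_univ _) (mem_univ _)
    simp only [sub_sub_cancel, Real.norm_eq_abs] at this
    exact this.trans (mul_le_mul_of_nonneg_right (le_max_right _ _) (abs_nonneg _))

lemma integrable_sub_mul_lamKernel {ε : ℝ} (hε : 0 < ε) (hε1 : ε < 1) (φ : SchwartzMap ℝ ℝ)
    (x : ℝ) : Integrable fun η : ℝ => (φ x - φ (x - η)) * lamKernel ε η := by
  obtain ⟨C, -, hC⟩ := φ.exists_abs_sub_le_min
  refine ((integrable_min_mul_lamKernel hε hε1).const_mul C).mono' ?_ (ae_of_all _ fun η => ?_)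
  · have : Continuous fun η : ℝ => φ x - φ (x - η) := by fun_prop
    exact (this.measurable.mul (measurable_lamKernel ε)).aestronglyMeasurable
  · rw [norm_mul, Real.norm_eq_abs, Real.norm_of_nonneg (lamKernel_nonneg _ _), ← mul_assoc]
    exact mul_le_mul_of_nonneg_right (hC x η) (lamKernel_nonneg _ _)

lemma aecover_lt_abs : AECover (volume : Measure ℝ) (𝓝[>] (0 : ℝ)) fun δ => {η : ℝ | δ < |η|} where
  ae_eventually_mem := by
    filter_upwards [compl_mem_ae_iff.2 (measure_singleton (0 : ℝ))] with η hη
    exact mem_nhdsWithin_of_mem_nhds (Iio_mem_nhds (abs_pos.2 hη))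
  measurableSet δ := measurableSet_lt measurable_const _root_.continuous_abs.measurable

lemma Lam_eq_integral {ε : ℝ} (hε : 0 < ε) (hε1 : ε < 1) (φ : SchwartzMap ℝ ℝ) (x : ℝ) :
    Lam ε φ x = ∫ η : ℝ, (φ x - φ (x - η)) * lamKernel ε η := by
  have h := aecover_lt_abs.integral_tendsto_of_countably_generated
    (integrable_sub_mul_lamKernel hε hε1 φ x)
  simp only [lamKernel, ← mul_div_assoc] at h ⊢
  exact h.limUnder_eq

lemma integrable_prod_mul_sub_mul_lamKernel {ε : ℝ} (hε : 0 < ε) (hε1 : ε < 1)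
    (φ : SchwartzMap ℝ ℝ) :
    Integrable (fun p : ℝ × ℝ => φ p.1 * ((φ p.1 - φ (p.1 - p.2)) * lamKernel ε p.2))
      (volume.prod volume) := by
  obtain ⟨C, -, hC⟩ := φ.exists_abs_sub_le_min
  have hint := φ.integrable.norm.mul_prod ((integrable_min_mul_lamKernel hε hε1).const_mul C)
    (μ := volume) (ν := volume)
  refine hint.mono' ?_ (ae_of_all _ fun p => ?_)
  · have h1 : Continuous fun p : ℝ × ℝ => φ p.1 := by fun_prop
    have h2 : Continuous fun p : ℝ × ℝ => φ p.1 - φ (p.1 - p.2) := by fun_prop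
    exact (h1.measurable.mul (h2.measurable.mul
      ((measurable_lamKernel ε).comp measurable_snd))).aestronglyMeasurable
  · rw [norm_mul, norm_mul, Real.norm_of_nonneg (lamKernel_nonneg _ _), ← mul_assoc C]
    exact mul_le_mul_of_nonneg_left
      (mul_le_mul_of_nonneg_right (hC _ _) (lamKernel_nonneg _ _)) (norm_nonneg _)

lemma integrable_prod_sq_sub_mul_lamKernel {ε : ℝ} (hε : 0 < ε) (hε1 : ε < 1)
    (φ : SchwartzMap ℝ ℝ) :
    Integrable (fun p : ℝ × ℝ => (φ p.1 - φ (p.1 - p.2)) ^ 2 * lamKernel ε p.2)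
      (volume.prod volume) := by
  obtain ⟨C, -, hC⟩ := φ.exists_abs_sub_le_min
  have hw := (integrable_min_mul_lamKernel hε hε1).const_mul C
  have hint := (φ.integrable.norm.mul_prod hw (μ := volume) (ν := volume)).add
    (hw.convolution_integrand (ContinuousLinearMap.mul ℝ ℝ) (φ.integrable (μ := volume)).norm)
  refine hint.mono' ?_ (ae_of_all _ fun p => ?_)
  · have h2 : Continuous fun p : ℝ × ℝ => (φ p.1 - φ (p.1 - p.2)) ^ 2 := by fun_prop
    exact (h2.measurable.mul ((measurable_lamKernel ε).comp measurable_snd)).aestronglyMeasurable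
  · have hk := lamKernel_nonneg ε p.2
    rw [norm_mul, Real.norm_of_nonneg hk, norm_pow, Real.norm_eq_abs]
    simp only [Pi.add_apply, ContinuousLinearMap.mul_apply', Real.norm_eq_abs]
    calc |φ p.1 - φ (p.1 - p.2)| ^ 2 * lamKernel ε p.2
        ≤ ((|φ p.1| + |φ (p.1 - p.2)|) * (C * min 1 |p.2|)) * lamKernel ε p.2 := by
          rw [sq]
          gcongr
          · exact abs_sub _ _
          · exact hC _ _
      _ = _ := by ring

lemma SchwartzMap.integral_sq_sub_translate (φ : SchwartzMap ℝ ℝ) (η : ℝ) :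
    ∫ x, (φ x - φ (x - η)) ^ 2 = 2 * ∫ x, φ x * (φ x - φ (x - η)) := by
  have hmul (a b : ℝ) : Integrable fun x => φ (x - a) * φ (x - b) := by
    obtain ⟨M, hM⟩ := φ.decay 0 0
    refine (φ.integrable.comp_sub_right a).mul_bdd (c := M) ?_ (ae_of_all _ fun x => ?_)
    · exact (by fun_prop : Continuous fun x => φ (x - b)).aestronglyMeasurable
    · simpa using hM.2 (x - b)
  have h0 : Integrable fun x => φ x * φ x := by simpa using hmul 0 0
  have h1 : Integrable fun x => φ x * φ (x - η) := by simpa using hmul 0 η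
  have htr : ∫ x, φ (x - η) * φ (x - η) = ∫ x, φ x * φ x :=
    integral_sub_right_eq_self (fun x => φ x * φ x) η
  calc ∫ x, (φ x - φ (x - η)) ^ 2
      = ∫ x, 2 * (φ x * φ x - φ x * φ (x - η)) + (φ (x - η) * φ (x - η) - φ x * φ x) := by
        congr with x; ring
    _ = 2 * ∫ x, (φ x * φ x - φ x * φ (x - η)) := by
        have h2 : Integrable fun x => 2 * (φ x * φ x - φ x * φ (x - η)) :=
          (h0.sub h1).const_mul 2
        have h3 : Integrable fun x => φ (x - η) * φ (x - η) - φ x * φ x := (hmul η η).sub h0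
        rw [integral_add h2 h3, integral_sub (hmul η η) h0, htr, sub_self, add_zero, integral_const_mul]
    _ = _ := by simp only [mul_sub]

/-- For every `0 < ε < 1` and every Schwartz function `φ : ℝ → ℝ`,
the operator `Λ^{1-ε}` is positive definite:
`∫ φ Λ^{1-ε}φ = (1/2) ∫∫ (φ(x) - φ(x-η))² |tanh(η/2)|^ε / sinh²(η/2) dη dx ≥ 0`. -/
theorem lam_positive_definite (ε : ℝ) (hε : 0 < ε) (hε1 : ε < 1) (φ : SchwartzMap ℝ ℝ) :
    ((∫ x : ℝ, φ x * Lam ε (⇑φ) x)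
      = (1 / 2) * ∫ x : ℝ, ∫ η : ℝ,
          (φ x - φ (x - η)) ^ 2 * |Real.tanh (η / 2)| ^ ε / Real.sinh (η / 2) ^ 2) ∧
    0 ≤ ∫ x : ℝ, φ x * Lam ε (⇑φ) x := by
  have key : (∫ x : ℝ, φ x * Lam ε (⇑φ) x)
      = (1 / 2) * ∫ x : ℝ, ∫ η : ℝ, (φ x - φ (x - η)) ^ 2 * lamKernel ε η := by
    simp only [Lam_eq_integral hε hε1, ← integral_const_mul (φ _)]
    rw [integral_integral_swap (integrable_prod_mul_sub_mul_lamKernel hε hε1 φ),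
      integral_integral_swap (f := fun x η => (φ x - φ (x - η)) ^ 2 * lamKernel ε η)
        (integrable_prod_sq_sub_mul_lamKernel hε hε1 φ),
      ← integral_const_mul]
    congr with η
    simp only [← mul_assoc, integral_mul_const, φ.integral_sq_sub_translate]
    ring
  constructor
  · simpa only [lamKernel, ← mul_div_assoc] using key
  · rw [key]
    exact mul_nonneg (by norm_num) <| integral_nonneg fun x => integral_nonneg fun η =>
      mul_nonneg (sq_nonneg _) (lamKernel_nonneg _ _)
end

section
/- For every 0 < ε < 1 and every Schwartz function φ : ℝ → ℝ, the derivative of Λ^{1−ε} can be written in the following two ways: Λ^{1−ε}(∂_x φ)(x) = p.v.∫_ℝ (∂_x φ(x) − ∂_x φ(x−η)) |tanh(η/2)|^ε / sinh²(η/2) dη, and also Λ^{1−ε}(∂_x φ)(x) = (1−ε) p.v.∫_ℝ (∂_x φ(x) − (φ(x) − φ(η))/sinh(x−η)) |tanh((x−η)/2)|^ε / sinh²((x−η)/2) dη + p.v.∫_ℝ (∂_x φ(x) − (φ(x) − φ(η))/tanh(x−η)) |tanh((x−η)/2)|^ε / sinh²((x−η)/2) dη + 4 ∂_x φ(x). 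-/
open MeasureTheory Real Filter Topology Set

namespace FiniteDepth

theorem self_le_add_one_mul_tanh {a : ℝ} (ha : 0 ≤ a) : a ≤ (a + 1) * Real.tanh a := by
  have hc := Real.cosh_pos a
  have hs : a ≤ Real.sinh a := Real.self_le_sinh_iff.2 ha
  have he : Real.cosh a - Real.sinh a ≤ 1 := by
    rw [Real.cosh_sub_sinh]; exact Real.exp_le_one_iff.2 (by linarith)
  rw [Real.tanh_eq_sinh_div_cosh, ← mul_div_assoc, le_div_iff₀ hc]
  nlinarith

theorem tanh_nonneg {a : ℝ} (ha : 0 ≤ a) : 0 ≤ Real.tanh a := by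
  rw [Real.tanh_eq_sinh_div_cosh]
  exact div_nonneg (Real.sinh_nonneg_iff.2 ha) (Real.cosh_pos a).le

theorem tanh_ne_zero {a : ℝ} (ha : a ≠ 0) : Real.tanh a ≠ 0 := by
  rw [Real.tanh_eq_sinh_div_cosh]
  exact div_ne_zero (by simpa [Real.sinh_eq_zero] using ha) (Real.cosh_pos a).ne'

theorem abs_tanh (a : ℝ) : |Real.tanh a| = Real.tanh |a| := by
  rw [Real.tanh_eq_sinh_div_cosh, Real.tanh_eq_sinh_div_cosh, abs_div, Real.abs_sinh,
    abs_of_pos (Real.cosh_pos a), Real.cosh_abs]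

theorem sinh_eq_half (s : ℝ) : Real.sinh s = 2 * Real.sinh (s / 2) * Real.cosh (s / 2) := by
  rw [← Real.sinh_two_mul]; congr 1; ring

theorem cosh_eq_half (s : ℝ) : Real.cosh s = 2 * Real.cosh (s / 2) ^ 2 - 1 := by
  have h := Real.cosh_two_mul (s / 2)
  rw [show 2 * (s / 2) = s by ring] at h
  rw [h, Real.cosh_sq]; ring

theorem continuous_tanh : Continuous Real.tanh := by
  rw [funext Real.tanh_eq_sinh_div_cosh]
  exact Real.continuous_sinh.div Real.continuous_cosh fun a => (Real.cosh_pos a).ne'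

theorem hasDerivAt_tanh (a : ℝ) : HasDerivAt Real.tanh (1 / Real.cosh a ^ 2) a := by
  have h := (Real.hasDerivAt_sinh a).div (Real.hasDerivAt_cosh a) (Real.cosh_pos a).ne'
  rw [funext Real.tanh_eq_sinh_div_cosh]
  refine h.congr_deriv ?_
  rw [← Real.cosh_sq_sub_sinh_sq a]; ring

theorem tendsto_tanh_atTop : Tendsto Real.tanh atTop (𝓝 1) := by
  have h : Tendsto (fun a : ℝ => 1 - Real.exp (-a)) atTop (𝓝 1) := by
    simpa using tendsto_const_nhds.sub Real.tendsto_exp_neg_atTop_nhds_zero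
  refine tendsto_of_tendsto_of_tendsto_of_le_of_le h tendsto_const_nhds (fun a => ?_)
    fun a => (Real.tanh_lt_one a).le
  change 1 - Real.exp (-a) ≤ Real.tanh a
  rw [← Real.cosh_sub_sinh, Real.tanh_eq_sinh_div_cosh, le_div_iff₀ (Real.cosh_pos a)]
  nlinarith [Real.one_le_cosh a, Real.cosh_sub_sinh a, Real.exp_pos (-a)]

/-- A quantity that is `O(s)` and bounded is `O(tanh (s / 2))`. -/
theorem abs_le_tanh_of_abs_le {A B s v : ℝ} (h1 : |v| ≤ A * |s|) (h2 : |v| ≤ B) :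
    |v| ≤ (2 * A + B) * |Real.tanh (s / 2)| := by
  rcases eq_or_ne s 0 with rfl | hs
  · simpa using h1
  have ha : 0 < |s| := abs_pos.2 hs
  have hA : 0 ≤ A := nonneg_of_mul_nonneg_left ((abs_nonneg v).trans h1) ha
  have hB : 0 ≤ B := (abs_nonneg v).trans h2
  have ht := self_le_add_one_mul_tanh (abs_nonneg (s / 2))
  rw [← abs_tanh] at ht
  have hh : |s / 2| = |s| / 2 := by rw [abs_div]; norm_num
  rw [hh] at ht
  have key : |v| * (|s| / 2 + 1) ≤ (2 * A + B) * (|s| / 2) := by nlinarith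
  have : (2 * A + B) * (|s| / 2) ≤ (2 * A + B) * ((|s| / 2 + 1) * |Real.tanh (s / 2)|) := by
    gcongr
  refine le_of_mul_le_mul_right (a := |s| / 2 + 1) ?_ (by positivity)
  linarith

theorem abs_one_sub_div_sinh_le {s : ℝ} (hs : s ≠ 0) :
    |1 - s / Real.sinh s| ≤ |Real.tanh (s / 2)| := by
  have key : ∀ a : ℝ, 0 < a → |1 - a / Real.sinh a| ≤ Real.tanh (a / 2) := by
    intro a ha
    have hS : 0 < Real.sinh a := Real.sinh_pos_iff.2 ha
    have hc := Real.cosh_pos (a / 2)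
    have hs2 : 0 < Real.sinh (a / 2) := Real.sinh_pos_iff.2 (by linarith)
    rw [abs_of_nonneg (sub_nonneg.2 ((div_le_one hS).2 (Real.self_le_sinh_iff.2 ha.le))),
      Real.tanh_eq_sinh_div_cosh, sub_le_comm, le_div_iff₀ hS, sinh_eq_half a]
    have h1 : Real.exp (-(a / 2)) * (2 * Real.sinh (a / 2)) = 1 - Real.exp (-a) := by
      rw [Real.sinh_eq, show -a = -(a / 2) + -(a / 2) by ring, Real.exp_add]
      have : Real.exp (-(a / 2)) * Real.exp (a / 2) = 1 := by
        rw [← Real.exp_add]; simp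
      linear_combination this
    have h2 : (1 - Real.sinh (a / 2) / Real.cosh (a / 2)) *
        (2 * Real.sinh (a / 2) * Real.cosh (a / 2)) =
        Real.exp (-(a / 2)) * (2 * Real.sinh (a / 2)) := by
      rw [← Real.cosh_sub_sinh]; field_simp
    rw [h2, h1]
    linarith [Real.add_one_le_exp (-a)]
  rcases hs.lt_or_gt with h | h
  · have := key (-s) (by linarith)
    rwa [Real.sinh_neg, neg_div_neg_eq, neg_div, Real.tanh_neg, ← abs_of_neg
      (a := Real.tanh (s / 2))] at this
    rw [Real.tanh_eq_sinh_div_cosh]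
    exact div_neg_of_neg_of_pos (Real.sinh_neg_iff.2 (by linarith)) (Real.cosh_pos _)
  · exact (key s h).trans (le_abs_self _)

/-- The convolution kernel `|tanh (s / 2)| ^ ε / sinh (s / 2) ^ 2` of `Λ^{1-ε}`. -/
noncomputable def kernel (ε s : ℝ) : ℝ :=
  |Real.tanh (s / 2)| ^ ε / Real.sinh (s / 2) ^ 2

variable {ε : ℝ}

theorem kernel_nonneg (ε s : ℝ) : 0 ≤ kernel ε s := by
  unfold kernel; positivity

theorem kernel_neg (ε s : ℝ) : kernel ε (-s) = kernel ε s := by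
  simp [kernel, neg_div, Real.tanh_neg, Real.sinh_neg]

theorem measurable_kernel (ε : ℝ) : Measurable (kernel ε) := by
  have h1 : Measurable fun s : ℝ => Real.tanh (s / 2) :=
    continuous_tanh.measurable.comp (measurable_id.div_const 2)
  have h2 : Measurable fun s : ℝ => Real.sinh (s / 2) :=
    Real.measurable_sinh.comp (measurable_id.div_const 2)
  exact (h1.abs.pow_const ε).div (h2.pow_const 2)

theorem kernel_mul_sinh (ε s : ℝ) :
    kernel ε s * Real.sinh s = 2 * |Real.tanh (s / 2)| ^ ε / Real.tanh (s / 2) := by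
  rcases eq_or_ne s 0 with rfl | hs
  · simp
  have h1 : Real.sinh (s / 2) ≠ 0 := by simpa [Real.sinh_eq_zero] using hs
  have h2 := (Real.cosh_pos (s / 2)).ne'
  rw [kernel, sinh_eq_half s, Real.tanh_eq_sinh_div_cosh]
  field_simp

theorem kernel_le_inv_sq (hε : 0 ≤ ε) (s : ℝ) : kernel ε s ≤ (Real.sinh (s / 2) ^ 2)⁻¹ := by
  rw [kernel, div_eq_mul_inv]
  exact mul_le_of_le_one_left (by positivity)
    (Real.rpow_le_one (abs_nonneg _) (Real.abs_tanh_lt_one _).le hε)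

theorem hasDerivAt_abs_tanh_rpow (ε : ℝ) {s : ℝ} (hs : s ≠ 0) :
    HasDerivAt (fun s : ℝ => |Real.tanh (s / 2)| ^ ε)
      (ε * |Real.tanh (s / 2)| ^ ε / Real.sinh s) s := by
  have ht : Real.tanh (s / 2) ≠ 0 := tanh_ne_zero (by simpa using hs)
  have h1 : Real.sinh (s / 2) ≠ 0 := by simpa [Real.sinh_eq_zero] using hs
  have h2 := (Real.cosh_pos (s / 2)).ne'
  have hd : HasDerivAt (fun s : ℝ => Real.tanh (s / 2)) (1 / Real.cosh (s / 2) ^ 2 * (1 / 2)) s :=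
    HasDerivAt.comp (h₂ := Real.tanh) (h := fun s => s / 2) s (hasDerivAt_tanh (s / 2)) ((hasDerivAt_id s).div_const 2)
  have h := (hd.pow 2).rpow_const (p := ε / 2) (Or.inl (pow_ne_zero 2 ht))
  have hsq : ∀ t : ℝ, (t ^ 2) ^ (ε / 2) = |t| ^ ε := by
    intro t
    rw [← sq_abs, ← Real.rpow_natCast, ← Real.rpow_mul (abs_nonneg t)]
    congr 1; push_cast; ring
  have hfun : (fun s : ℝ => |Real.tanh (s / 2)| ^ ε) =
      fun s : ℝ => (Real.tanh (s / 2) ^ 2) ^ (ε / 2) := by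
    funext u; exact (hsq _).symm
  rw [hfun]
  refine h.congr_deriv ?_
  simp only [Pi.pow_apply]
  rw [Real.rpow_sub_one (pow_ne_zero 2 ht), hsq, sinh_eq_half s]
  generalize |Real.tanh (s / 2)| ^ ε = r
  field_simp
  norm_num
  rw [Real.tanh_eq_sinh_div_cosh]
  field_simp

theorem hasDerivAt_kernel (ε : ℝ) {s : ℝ} (hs : s ≠ 0) :
    HasDerivAt (kernel ε) (kernel ε s * ((ε - 1 - Real.cosh s) / Real.sinh s)) s := by
  have h1 : Real.sinh (s / 2) ≠ 0 := by simpa [Real.sinh_eq_zero] using hs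
  have h2 := (Real.cosh_pos (s / 2)).ne'
  have hd : HasDerivAt (fun s : ℝ => Real.sinh (s / 2)) (Real.cosh (s / 2) * (1 / 2)) s :=
    HasDerivAt.comp (h₂ := Real.sinh) (h := fun s => s / 2) s (Real.hasDerivAt_sinh (s / 2))
      ((hasDerivAt_id s).div_const 2)
  refine ((hasDerivAt_abs_tanh_rpow ε hs).div (hd.pow 2) (pow_ne_zero 2 h1)).congr_deriv ?_
  simp only [Pi.pow_apply]
  rw [kernel, cosh_eq_half s, sinh_eq_half s]
  field_simp
  ring

theorem integrable_tanh_mul_kernel (hε : 0 < ε) :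
    Integrable fun s : ℝ => |Real.tanh (s / 2)| * kernel ε s := by
  have hpos : IntegrableOn (fun s : ℝ => |Real.tanh (s / 2)| * kernel ε s) (Ioi 0) := by
    have hc : Continuous fun s : ℝ => 2 / ε * |Real.tanh (s / 2)| ^ ε :=
      continuous_const.mul
        (((continuous_tanh.comp (continuous_id.div_const 2)).abs).rpow_const fun _ => Or.inr hε.le)
    refine integrableOn_Ioi_deriv_of_nonneg (l := 2 / ε * |(1 : ℝ)| ^ ε)
      (g := fun s : ℝ => 2 / ε * |Real.tanh (s / 2)| ^ ε) hc.continuousWithinAt ?_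
      (fun s _ => mul_nonneg (abs_nonneg _) (kernel_nonneg _ _)) ?_
    · intro s hs
      have hs : 0 < s := hs
      have h1 : 0 < Real.sinh (s / 2) := Real.sinh_pos_iff.2 (by linarith)
      have h2 := Real.cosh_pos (s / 2)
      refine ((hasDerivAt_abs_tanh_rpow ε hs.ne').const_mul (2 / ε)).congr_deriv ?_
      rw [kernel]
      generalize |Real.tanh (s / 2)| ^ ε = r
      rw [abs_of_nonneg (tanh_nonneg (by linarith)), Real.tanh_eq_sinh_div_cosh, sinh_eq_half s]
      field_simp
    · exact (((tendsto_tanh_atTop.comp (tendsto_id.atTop_div_const two_pos)).abs).rpow_const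
        (Or.inr hε.le)).const_mul _
  have heven : ∀ s : ℝ, |Real.tanh (-s / 2)| * kernel ε (-s) =
      |Real.tanh (s / 2)| * kernel ε s := by
    intro s
    rw [kernel_neg, neg_div, Real.tanh_neg, abs_neg]
  have hneg : IntegrableOn (fun s : ℝ => |Real.tanh (s / 2)| * kernel ε s) (Iic 0) := by
    let m : MeasurableEmbedding fun s : ℝ => -s := (Homeomorph.neg ℝ).measurableEmbedding
    rw [← Measure.map_neg_eq_self (volume : Measure ℝ), m.integrableOn_map_iff]
    simp_rw [Function.comp_def, heven, neg_preimage, neg_Iic, neg_zero]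
    exact Iff.mpr integrableOn_Ici_iff_integrableOn_Ioi hpos
  rw [← integrableOn_univ, ← Iic_union_Ioi (a := (0 : ℝ))]
  exact hneg.union hpos

theorem integrable_mul_kernel (hε : 0 < ε) {F : ℝ → ℝ} (hF : Measurable F) {C : ℝ}
    (h : ∀ s, s ≠ 0 → |F s| ≤ C * |Real.tanh (s / 2)|) :
    Integrable fun s => F s * kernel ε s := by
  refine ((integrable_tanh_mul_kernel hε).const_mul C).mono'
    (hF.mul (measurable_kernel ε)).aestronglyMeasurable (Eventually.of_forall fun s => ?_)
  rcases eq_or_ne s 0 with rfl | hs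
  · simp [kernel]
  rw [Real.norm_eq_abs, abs_mul, abs_of_nonneg (kernel_nonneg ε s), ← mul_assoc]
  exact mul_le_mul_of_nonneg_right (h s hs) (kernel_nonneg ε s)

theorem tendsto_kernel_mul_atTop (hε : 0 < ε) (p : ℝ) {g : ℝ → ℝ} {B : ℝ}
    (hg : ∀ s, |g s| ≤ B) :
    Tendsto (fun s => kernel ε s * (p * Real.sinh s - g s)) atTop (𝓝 (2 * p)) := by
  have hhalf : Tendsto (fun s : ℝ => s / 2) atTop atTop := tendsto_id.atTop_div_const two_pos
  have ht : Tendsto (fun s : ℝ => Real.tanh (s / 2)) atTop (𝓝 1) := tendsto_tanh_atTop.comp hhalf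
  have h1 : Tendsto (fun s => kernel ε s * Real.sinh s) atTop (𝓝 2) := by
    simp only [kernel_mul_sinh]
    have h := ((ht.abs.rpow_const (p := ε) (Or.inr hε.le)).const_mul 2).div ht one_ne_zero
    rw [abs_one, Real.one_rpow, mul_one, div_one] at h
    exact h
  have hsinh : Tendsto (fun s : ℝ => Real.sinh (s / 2)) atTop atTop :=
    (tendsto_atTop_mono' _ ((eventually_ge_atTop 0).mono fun a ha =>
      Real.self_le_sinh_iff.2 ha) tendsto_id).comp hhalf
  have hk : Tendsto (kernel ε) atTop (𝓝 0) :=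
    squeeze_zero (kernel_nonneg ε) (kernel_le_inv_sq hε.le)
      ((tendsto_pow_atTop two_ne_zero).comp hsinh).inv_tendsto_atTop
  have h2 : Tendsto (fun s => kernel ε s * g s) atTop (𝓝 0) := by
    refine squeeze_zero_norm (fun s => ?_) (by simpa using hk.mul_const B)
    rw [norm_mul, Real.norm_eq_abs, abs_of_nonneg (kernel_nonneg ε s)]
    exact mul_le_mul_of_nonneg_left (hg s) (kernel_nonneg ε s)
  have := (h1.const_mul p).sub h2
  rw [sub_zero, mul_comm p 2] at this
  exact this.congr fun s => by ring

theorem tendsto_kernel_mul_atBot (hε : 0 < ε) (p : ℝ) {g : ℝ → ℝ} {B : ℝ}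
    (hg : ∀ s, |g s| ≤ B) :
    Tendsto (fun s => kernel ε s * (p * Real.sinh s - g s)) atBot (𝓝 (-(2 * p))) := by
  have h := (tendsto_kernel_mul_atTop hε (-p) (g := fun s => g (-s)) fun s => hg (-s)).comp
    tendsto_neg_atBot_atTop
  rw [mul_neg] at h
  refine h.congr fun s => ?_
  simp only [Function.comp_apply, kernel_neg, Real.sinh_neg, neg_neg]
  ring

theorem hasPV_of_integrable {F : ℝ → ℝ} (hF : Integrable F) : HasPV F (∫ s, F s) := by
  have hcover : AECover (volume : Measure ℝ) (𝓝[>] (0 : ℝ)) fun δ : ℝ => {η : ℝ | δ < |η|} := by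
    refine ⟨?_, fun δ => measurableSet_lt measurable_const measurable_id.abs⟩
    filter_upwards [compl_mem_ae_iff.2 (measure_singleton (0 : ℝ))] with η hη
    exact nhdsWithin_le_nhds (gt_mem_nhds (abs_pos.2 hη))
  exact hcover.integral_tendsto_of_countably_generated hF

theorem hasPVat_comp_sub {F : ℝ → ℝ} {I : ℝ} (c : ℝ) (hF : HasPV F I) :
    HasPVat c (fun η => F (c - η)) I := by
  refine hF.congr fun δ => ?_
  have hm : MeasurableSet {η : ℝ | δ < |η|} := measurableSet_lt measurable_const measurable_id.abs
  have hm' : MeasurableSet {η : ℝ | δ < |η - c|} :=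
    measurableSet_lt measurable_const (measurable_id.sub_const c).abs
  rw [← integral_indicator hm, ← integral_indicator hm', ← integral_sub_left_eq_self _ volume c]
  congr 1
  funext η
  simp only [indicator, mem_ofPred_eq, abs_sub_comm c η]

/-- The remainder `φ'(x) - (φ(x) - φ(x-s)) / sinh s` is `O(tanh (s / 2))`. -/
theorem abs_sub_div_sinh_le {f f' : ℝ → ℝ} (hf : ∀ y, HasDerivAt f (f' y) y) {B₁ B₂ : ℝ}
    (h₁ : ∀ y, |f' y| ≤ B₁) (h₂ : ∀ y z, |f' y - f' z| ≤ B₂ * |y - z|) (x : ℝ) {s : ℝ}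
    (hs : s ≠ 0) :
    |f' x - (f x - f (x - s)) / Real.sinh s| ≤
      (3 * B₁ + 2 * B₂) * |Real.tanh (s / 2)| := by
  have hB₁ : 0 ≤ B₁ := (abs_nonneg _).trans (h₁ x)
  have hB₂ : 0 ≤ B₂ := by simpa using (abs_nonneg _).trans (h₂ 1 0)
  have hder : ∀ y, HasDerivAt (fun y => f' x * y - (f x - f (x - y))) (f' x - f' (x - y)) y := by
    intro y
    have h := (hf (x - y)).comp y ((hasDerivAt_id y).const_sub x)
    refine (((hasDerivAt_id y).const_mul (f' x)).sub (h.const_sub (f x))).congr_deriv ?_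
    simp
  have key : ∀ C : ℝ, (∀ y ∈ uIcc 0 s, |f' x - f' (x - y)| ≤ C) →
      |f' x * s - (f x - f (x - s))| ≤ C * |s| := by
    intro C hC
    have := (convex_uIcc (0 : ℝ) s).norm_image_sub_le_of_norm_hasDerivWithin_le
      (fun y _ => (hder y).hasDerivWithinAt) hC left_mem_uIcc right_mem_uIcc
    simpa using this
  have hS : |s| ≤ |Real.sinh s| := by
    rw [Real.abs_sinh]; exact Real.self_le_sinh_iff.2 (abs_nonneg s)
  have hs0 : 0 < |s| := abs_pos.2 hs
  have hdiv : ∀ C : ℝ, 0 ≤ C → |f' x * s - (f x - f (x - s))| ≤ C * |s| →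
      |(f' x * s - (f x - f (x - s))) / Real.sinh s| ≤ C := by
    intro C hC h
    rw [abs_div, div_le_iff₀ (hs0.trans_le hS)]
    exact h.trans (mul_le_mul_of_nonneg_left hS hC)
  have hA := hdiv (B₂ * |s|) (by positivity) <| key _ fun y hy => by
    have h := h₂ x (x - y)
    rw [sub_sub_cancel] at h
    refine h.trans (mul_le_mul_of_nonneg_left ?_ hB₂)
    simpa using abs_sub_left_of_mem_uIcc hy
  have hB := hdiv (2 * B₁) (by positivity) <| key _ fun y _ => by
    linarith [abs_sub (f' x) (f' (x - y)), h₁ x, h₁ (x - y)]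
  have h3 := abs_le_tanh_of_abs_le hA hB
  have h4 : |f' x * (1 - s / Real.sinh s)| ≤ B₁ * |Real.tanh (s / 2)| := by
    rw [abs_mul]
    exact mul_le_mul (h₁ x) (abs_one_sub_div_sinh_le hs) (abs_nonneg _) hB₁
  have hsplit : f' x - (f x - f (x - s)) / Real.sinh s =
      f' x * (1 - s / Real.sinh s) + (f' x * s - (f x - f (x - s))) / Real.sinh s := by ring
  rw [hsplit]
  refine (abs_add_le _ _).trans ?_
  linarith

theorem div_tanh_eq (g : ℝ) {s : ℝ} (hs : s ≠ 0) :
    g / Real.tanh s = g / Real.sinh s + g * Real.tanh (s / 2) := by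
  have h1 : Real.sinh (s / 2) ≠ 0 := by simpa [Real.sinh_eq_zero] using hs
  have h2 := (Real.cosh_pos (s / 2)).ne'
  have hS : Real.sinh s ≠ 0 := by simpa [Real.sinh_eq_zero] using hs
  rw [Real.tanh_eq_sinh_div_cosh s, Real.tanh_eq_sinh_div_cosh, div_div_eq_mul_div,
    cosh_eq_half s, sinh_eq_half s, div_add' _ _ _ (by positivity)]
  rw [div_left_inj' (by positivity)]
  field_simp
  rw [Real.cosh_sq]
  ring

theorem hasDerivAt_kernel_mul (ε : ℝ) {f f' : ℝ → ℝ} (hf : ∀ y, HasDerivAt f (f' y) y) (x : ℝ)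
    {s : ℝ} (hs : s ≠ 0) :
    HasDerivAt (fun s => kernel ε s * (f' x * Real.sinh s - (f x - f (x - s))))
      ((f' x - f' (x - s)) * kernel ε s
        - (1 - ε) * ((f' x - (f x - f (x - s)) / Real.sinh s) * kernel ε s)
        - (f' x - (f x - f (x - s)) / Real.tanh s) * kernel ε s) s := by
  have hS : Real.sinh s ≠ 0 := by simpa [Real.sinh_eq_zero] using hs
  have hC := (Real.cosh_pos s).ne'
  have h := (hf (x - s)).comp s ((hasDerivAt_id s).const_sub x)
  refine ((hasDerivAt_kernel ε hs).mul
    (((Real.hasDerivAt_sinh s).const_mul (f' x)).sub (h.const_sub (f x)))).congr_deriv ?_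
  rw [Real.tanh_eq_sinh_div_cosh]
  simp only [Function.comp_apply, Pi.sub_apply]
  field_simp
  ring

theorem continuousAt_kernel_mul (hε : 0 < ε) {f f' : ℝ → ℝ} {x C : ℝ}
    (h : ∀ s, s ≠ 0 →
      |f' x - (f x - f (x - s)) / Real.sinh s| ≤ C * |Real.tanh (s / 2)|) :
    ContinuousAt (fun s => kernel ε s * (f' x * Real.sinh s - (f x - f (x - s)))) 0 := by
  have hc : Continuous fun s : ℝ => 2 * C * |Real.tanh (s / 2)| ^ ε :=
    continuous_const.mul
      (((continuous_tanh.comp (continuous_id.div_const 2)).abs).rpow_const fun _ => Or.inr hε.le)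
  have h0 : Tendsto (fun s : ℝ => 2 * C * |Real.tanh (s / 2)| ^ ε) (𝓝 0) (𝓝 0) := by
    simpa [hε.ne'] using hc.tendsto 0
  rw [ContinuousAt]
  simp only [sub_zero, sub_self, Real.sinh_zero, mul_zero]
  refine squeeze_zero_norm (fun s => ?_) h0
  rcases eq_or_ne s 0 with rfl | hs
  · simp [hε.ne']
  have hS : Real.sinh s ≠ 0 := by simpa [Real.sinh_eq_zero] using hs
  have ht : |Real.tanh (s / 2)| ≠ 0 := abs_ne_zero.2 (tanh_ne_zero (by simpa using hs))
  have hrw : kernel ε s * (f' x * Real.sinh s - (f x - f (x - s))) =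
      kernel ε s * Real.sinh s * (f' x - (f x - f (x - s)) / Real.sinh s) := by
    field_simp
  rw [hrw, kernel_mul_sinh, Real.norm_eq_abs, abs_mul, abs_div, abs_mul, abs_two,
    abs_of_nonneg (Real.rpow_nonneg (abs_nonneg _) ε)]
  refine (mul_le_mul_of_nonneg_left (h s hs) (by positivity)).trans_eq ?_
  field_simp

theorem _root_.SchwartzMap.exists_abs_le_s5 (f : SchwartzMap ℝ ℝ) : ∃ C, ∀ y, |f y| ≤ C := by
  obtain ⟨C, hC⟩ := f.decay 0 0
  exact ⟨C, fun y => by simpa using hC.2 y⟩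

end FiniteDepth

/-- For every `0 < ε < 1` and every Schwartz function `φ`, the derivative
of `Λ^{1-ε}` can be written in two ways: `Λ^{1-ε}(∂_x φ)(x)` equals the principal value
`p.v.∫ (∂_x φ(x) - ∂_x φ(x-η)) |tanh(η/2)|^ε / sinh²(η/2) dη`, and also equals
`(1-ε) p.v.∫ (∂_x φ(x) - (φ(x)-φ(η))/sinh(x-η)) |tanh((x-η)/2)|^ε / sinh²((x-η)/2) dη
 + p.v.∫ (∂_x φ(x) - (φ(x)-φ(η))/tanh(x-η)) |tanh((x-η)/2)|^ε / sinh²((x-η)/2) dη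
 + 4 ∂_x φ(x)`. -/
theorem lam_deriv_two_forms (ε : ℝ) (hε : 0 < ε) (hε1 : ε < 1) (φ : SchwartzMap ℝ ℝ)
    (x : ℝ) :
    HasPV
      (fun η => (deriv (⇑φ) x - deriv (⇑φ) (x - η)) * |Real.tanh (η / 2)| ^ ε
          / Real.sinh (η / 2) ^ 2)
      (Lam ε (deriv (⇑φ)) x) ∧
    ∃ I1 I2 : ℝ,
      HasPVat x
        (fun η => (deriv (⇑φ) x - (φ x - φ η) / Real.sinh (x - η))
            * |Real.tanh ((x - η) / 2)| ^ ε / Real.sinh ((x - η) / 2) ^ 2) I1 ∧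
      HasPVat x
        (fun η => (deriv (⇑φ) x - (φ x - φ η) / Real.tanh (x - η))
            * |Real.tanh ((x - η) / 2)| ^ ε / Real.sinh ((x - η) / 2) ^ 2) I2 ∧
      Lam ε (deriv (⇑φ)) x = (1 - ε) * I1 + I2 + 4 * deriv (⇑φ) x := by
  obtain ⟨B₀, hB₀⟩ := φ.exists_abs_le_s5
  obtain ⟨B₁, hB₁⟩ := (SchwartzMap.derivCLM ℝ ℝ φ).exists_abs_le_s5
  obtain ⟨B₂, hB₂⟩ := (SchwartzMap.derivCLM ℝ ℝ (SchwartzMap.derivCLM ℝ ℝ φ)).exists_abs_le_s5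
  have hcoe : (SchwartzMap.derivCLM ℝ ℝ φ : ℝ → ℝ) = deriv φ :=
    funext fun y => SchwartzMap.derivCLM_apply ℝ φ y
  simp only [SchwartzMap.derivCLM_apply, hcoe] at hB₁ hB₂
  have hf : ∀ y, HasDerivAt φ (deriv φ y) y := fun y => φ.differentiableAt.hasDerivAt
  have hf' : Differentiable ℝ (deriv φ) := hcoe ▸ (SchwartzMap.derivCLM ℝ ℝ φ).differentiable
  have hLip : ∀ y z, |deriv φ y - deriv φ z| ≤ B₂ * |y - z| := fun y z =>
    convex_univ.norm_image_sub_le_of_norm_deriv_le (fun w _ => hf' w) (fun w _ => hB₂ w)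
      (mem_univ z) (mem_univ y)
  have hg : ∀ s, |φ x - φ (x - s)| ≤ 2 * B₀ := fun s => by
    linarith [abs_sub (φ x) (φ (x - s)), hB₀ x, hB₀ (x - s)]
  have mg : Measurable fun s => φ x - φ (x - s) :=
    (continuous_const.sub (φ.continuous.comp (continuous_const.sub continuous_id))).measurable
  have b₂ := fun s (hs : s ≠ 0) => FiniteDepth.abs_sub_div_sinh_le hf hB₁ hLip x hs
  have i₁ : Integrable fun s => (deriv φ x - deriv φ (x - s)) * FiniteDepth.kernel ε s := by
    refine FiniteDepth.integrable_mul_kernel hε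
      (continuous_const.sub (hf'.continuous.comp (continuous_const.sub continuous_id))).measurable
      (C := 2 * B₂ + 2 * B₁) fun s _ => FiniteDepth.abs_le_tanh_of_abs_le ?_ ?_
    · simpa using hLip x (x - s)
    · linarith [abs_sub (deriv φ x) (deriv φ (x - s)), hB₁ x, hB₁ (x - s)]
  have i₂ : Integrable fun s =>
      (deriv φ x - (φ x - φ (x - s)) / Real.sinh s) * FiniteDepth.kernel ε s :=
    FiniteDepth.integrable_mul_kernel hε
      (measurable_const.sub (mg.div Real.measurable_sinh)) b₂
  have i₃ : Integrable fun s =>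
      (deriv φ x - (φ x - φ (x - s)) / Real.tanh s) * FiniteDepth.kernel ε s := by
    refine FiniteDepth.integrable_mul_kernel hε
      (measurable_const.sub (mg.div FiniteDepth.continuous_tanh.measurable))
      (C := 3 * B₁ + 2 * B₂ + 2 * B₀) fun s hs => ?_
    rw [FiniteDepth.div_tanh_eq _ hs, ← sub_sub]
    refine (abs_sub _ _).trans ?_
    rw [abs_mul, add_mul]
    exact add_le_add (b₂ s hs) (mul_le_mul_of_nonneg_right (hg s) (abs_nonneg _))
  have pv₁ := FiniteDepth.hasPV_of_integrable i₁
  have pv₂ := FiniteDepth.hasPVat_comp_sub x (FiniteDepth.hasPV_of_integrable i₂)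
  have pv₃ := FiniteDepth.hasPVat_comp_sub x (FiniteDepth.hasPV_of_integrable i₃)
  simp only [FiniteDepth.kernel, sub_sub_cancel, ← mul_div_assoc] at pv₁ pv₂ pv₃
  have hLam : Lam ε (deriv φ) x = _ := pv₁.limUnder_eq
  rw [hLam]
  refine ⟨pv₁, _, _, pv₂, pv₃, ?_⟩
  simp only [mul_div_assoc]
  change (∫ s, (deriv φ x - deriv φ (x - s)) * FiniteDepth.kernel ε s) =
    (1 - ε) * (∫ s, (deriv φ x - (φ x - φ (x - s)) / Real.sinh s) * FiniteDepth.kernel ε s) +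
    (∫ s, (deriv φ x - (φ x - φ (x - s)) / Real.tanh s) * FiniteDepth.kernel ε s) +
    4 * deriv φ x
  have iD := (i₁.sub (i₂.const_mul (1 - ε))).sub i₃
  have hcont := FiniteDepth.continuousAt_kernel_mul (f := φ) (f' := deriv φ) (x := x) hε b₂
  have hIoi := integral_Ioi_of_hasDerivAt_of_tendsto hcont.continuousWithinAt
    (fun s hs => FiniteDepth.hasDerivAt_kernel_mul ε hf x (ne_of_gt hs)) iD.integrableOn
    (FiniteDepth.tendsto_kernel_mul_atTop hε (deriv φ x) hg)
  have hIic := integral_Iic_of_hasDerivAt_of_tendsto hcont.continuousWithinAt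
    (fun s hs => FiniteDepth.hasDerivAt_kernel_mul ε hf x (ne_of_lt hs)) iD.integrableOn
    (FiniteDepth.tendsto_kernel_mul_atBot hε (deriv φ x) hg)
  have hsum := intervalIntegral.integral_Iic_add_Ioi (b := (0 : ℝ)) iD.integrableOn
    iD.integrableOn
  have hsub := integral_sub (i₁.sub (i₂.const_mul (1 - ε))) i₃
  have hsub' := integral_sub i₁ (i₂.const_mul (1 - ε))
  rw [integral_const_mul] at hsub'
  simp only [Pi.sub_apply] at hsum hsub hsub'
  rw [hIoi, hIic, hsub, hsub'] at hsum
  linarith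
end

section
/- Let σ, θ ∈ (0, π/2) with σ + θ < π/2, set θ̄ = π/2 − σ − θ ∈ (0, π/2), and let t ∈ (0, 1]. Then tan(θ)/(t + tan²(θ)) + tan(σ)/(tan²(σ) + t) − cot(θ̄)/(t + cot²(θ̄)) ≥ 0. -/
open Real Set

/-- The rational inequality behind `muskat_sign_inequality`, in terms of the two tangents. -/
theorem div_one_sub_mul_div_le_add_div {a b t : ℝ} (ha : 0 < a) (hb : 0 < b) (hab : a * b < 1)
    (ht : 0 < t) (ht1 : t ≤ 1) :
    (a + b) / (1 - a * b) / (t + ((a + b) / (1 - a * b)) ^ 2) ≤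
      a / (t + a ^ 2) + b / (b ^ 2 + t) := by
  have hq : 0 < 1 - a * b := sub_pos.2 hab
  have hp : 0 < a * b := mul_pos ha hb
  have hD : 0 < t * (1 - a * b) ^ 2 + (a + b) ^ 2 := by positivity
  have key : 0 ≤ (1 + t) * (a + b) ^ 2 +
      (1 - a * b) * (3 * t - t ^ 2 - t * (a * b) - a * b) := by
    have h1 : 0 ≤ (1 + t) * (a - b) ^ 2 := by positivity
    have h2 : 0 ≤ (1 - a * b) * (t * (3 - t)) :=
      mul_nonneg hq.le (mul_nonneg ht.le (by linarith))
    have h3 : 0 ≤ (1 + t) * (a * b) * (3 + a * b) := by positivity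
    linarith
  have hlhs : (a + b) / (1 - a * b) / (t + ((a + b) / (1 - a * b)) ^ 2) =
      (a + b) * (1 - a * b) / (t * (1 - a * b) ^ 2 + (a + b) ^ 2) := by
    field_simp
  rw [hlhs, div_add_div _ _ (by positivity) (by positivity), div_le_div_iff₀ hD (by positivity)]
  have := mul_nonneg (mul_pos (add_pos ha hb) hp).le key
  linarith

/-- Key sign inequality for the amplitude maximum principle: for
`σ, θ ∈ (0, π/2)` with `σ + θ < π/2`, `θ̄ = π/2 - σ - θ ∈ (0, π/2)` and `t ∈ (0, 1]`,
`tan θ/(t + tan²θ) + tan σ/(tan²σ + t) - cot θ̄/(t + cot²θ̄) ≥ 0`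
(where `cot θ̄ = (tan θ̄)⁻¹`). -/
theorem muskat_sign_inequality (σ θ t : ℝ)
    (hσ : σ ∈ Set.Ioo 0 (π / 2)) (hθ : θ ∈ Set.Ioo 0 (π / 2))
    (hsum : σ + θ < π / 2) (ht : t ∈ Set.Ioc (0:ℝ) 1) :
    0 ≤ Real.tan θ / (t + Real.tan θ ^ 2) + Real.tan σ / (Real.tan σ ^ 2 + t)
        - (Real.tan (π / 2 - σ - θ))⁻¹ / (t + ((Real.tan (π / 2 - σ - θ))⁻¹) ^ 2) := by
  obtain ⟨hσ0, hσ1⟩ := hσ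
  obtain ⟨hθ0, hθ1⟩ := hθ
  have ha : 0 < tan θ := tan_pos_of_pos_of_lt_pi_div_two hθ0 hθ1
  have hb : 0 < tan σ := tan_pos_of_pos_of_lt_pi_div_two hσ0 hσ1
  have hcθ : 0 < cos θ := cos_pos_of_mem_Ioo ⟨by linarith, hθ1⟩
  have hcσ : 0 < cos σ := cos_pos_of_mem_Ioo ⟨by linarith, hσ1⟩
  have hc : 0 < cos (θ + σ) := cos_pos_of_mem_Ioo ⟨by linarith, by linarith⟩
  have hab : tan θ * tan σ < 1 := by
    rw [cos_add] at hc
    rw [tan_eq_sin_div_cos, tan_eq_sin_div_cos, div_mul_div_comm, div_lt_one (by positivity)]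
    linarith
  have hcot : (tan (π / 2 - σ - θ))⁻¹ = (tan θ + tan σ) / (1 - tan θ * tan σ) := by
    rw [show π / 2 - σ - θ = π / 2 - (θ + σ) by ring, tan_pi_div_two_sub, inv_inv]
    rw [cos_add] at hc
    have hq : 1 - tan θ * tan σ ≠ 0 := (sub_pos.2 hab).ne'
    rw [eq_div_iff hq, tan_eq_sin_div_cos (θ + σ), sin_add, cos_add, tan_eq_sin_div_cos θ,
      tan_eq_sin_div_cos σ]
    have := hc.ne'
    rw [mul_comm (cos θ)] at this
    field_simp
  rw [hcot]
  exact sub_nonneg.2 (div_one_sub_mul_div_le_add_div ha hb hab ht.1 ht.2)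
end

section
/- Let 0 < ε < 1/10 and let g : ℝ → ℝ be continuously differentiable with ‖g‖_{L^∞(ℝ)} < π/4 and 0 < ∂_x g(x0) ≤ 1 at some point x0. For η ∈ ℝ set θ̄ = (g(x0) + g(η))/2, s = (x0 − η)/2 and μ2 = tan(θ̄) tanh(s). Then the integral A9 = ∫_ℝ [ −∂_x g(x0) μ2² + ((∂_x g(x0))² − 1) μ2 + ∂_x g(x0) ] / [ cosh²(s) cos²(θ̄) (1 + tan²(θ̄) tanh²(s) / |tanh(s)|^{2ε})² ] dη satisfies |A9| ≤ 4 sec²(‖g‖_{L^∞}) ( tan(‖g‖_{L^∞}) + ∂_x g(x0) ). -/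
open Real Set MeasureTheory

lemma Real.sq_le_sinh_sq (x : ℝ) : x ^ 2 ≤ Real.sinh x ^ 2 := by
  rw [← sq_abs x, ← sq_abs (Real.sinh x), Real.abs_sinh]
  exact pow_le_pow_left₀ (abs_nonneg x) (Real.self_le_sinh_iff.2 (abs_nonneg x)) 2

lemma integrable_inv_cosh_sq : Integrable fun x : ℝ => (Real.cosh x ^ 2)⁻¹ := by
  refine integrable_inv_one_add_sq.mono' ?_ (Filter.Eventually.of_forall fun x => ?_)
  · exact ((Real.continuous_cosh.pow 2).inv₀
      fun x => (pow_pos (Real.cosh_pos x) 2).ne').aestronglyMeasurable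
  · rw [Real.norm_of_nonneg (by positivity)]
    have := Real.sq_le_sinh_sq x
    exact inv_anti₀ (by positivity) (by rw [Real.cosh_sq]; linarith)

lemma Real.hasDerivAt_tanh (x : ℝ) : HasDerivAt Real.tanh (Real.cosh x ^ 2)⁻¹ x := by
  have h := (Real.hasDerivAt_sinh x).div (Real.hasDerivAt_cosh x) (Real.cosh_pos x).ne'
  have hfun : Real.tanh = Real.sinh / Real.cosh := funext Real.tanh_eq_sinh_div_cosh
  have hnum : Real.cosh x * Real.cosh x - Real.sinh x * Real.sinh x = 1 := by
    linarith [Real.cosh_sq_sub_sinh_sq x]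
  rw [hnum, one_div] at h
  rwa [hfun]

lemma Real.tendsto_tanh_atTop : Filter.Tendsto Real.tanh Filter.atTop (nhds 1) := by
  have hexp : Filter.Tendsto (fun x : ℝ => Real.exp (-(2 * x))) Filter.atTop (nhds 0) :=
    Real.tendsto_exp_neg_atTop_nhds_zero.comp
      (Filter.tendsto_id.const_mul_atTop (zero_lt_two' ℝ))
  have h := (hexp.const_sub 1).div (hexp.const_add 1) (by norm_num)
  norm_num at h
  refine h.congr fun x => ?_
  have hx : Real.exp (-(2 * x)) = Real.exp (-x) / Real.exp x := by
    rw [← Real.exp_sub]; ring_nf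
  rw [Pi.div_apply, Real.tanh_eq, hx]
  have := Real.exp_pos x
  field_simp

lemma Real.tendsto_tanh_atBot : Filter.Tendsto Real.tanh Filter.atBot (nhds (-1)) := by
  refine (Real.tendsto_tanh_atTop.comp Filter.tendsto_neg_atBot_atTop).neg.congr fun x => ?_
  simp

lemma integral_inv_cosh_sq : ∫ x : ℝ, (Real.cosh x ^ 2)⁻¹ = 2 := by
  rw [integral_of_hasDerivAt_of_tendsto Real.hasDerivAt_tanh integrable_inv_cosh_sq
    Real.tendsto_tanh_atBot Real.tendsto_tanh_atTop]
  norm_num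

lemma abs_slope_numerator_le {p m T : ℝ} (hp : 0 ≤ p) (hp1 : p ≤ 1) (hm : |m| ≤ T)
    (hT : T ≤ 1) : |-p * m ^ 2 + (p ^ 2 - 1) * m + p| ≤ T + p := by
  have hm2 : m ^ 2 ≤ 1 := (sq_le_one_iff_abs_le_one m).2 (hm.trans hT)
  have hquad : |p * (1 - m ^ 2)| ≤ p := by
    rw [abs_of_nonneg (mul_nonneg hp (by linarith))]
    nlinarith [sq_nonneg m]
  have hlin : |(p ^ 2 - 1) * m| ≤ |m| := by
    rw [abs_mul]
    refine mul_le_of_le_one_left (abs_nonneg m) (abs_le.2 ⟨?_, ?_⟩) <;> nlinarith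
  calc |-p * m ^ 2 + (p ^ 2 - 1) * m + p| = |(p ^ 2 - 1) * m + p * (1 - m ^ 2)| := by ring_nf
    _ ≤ |(p ^ 2 - 1) * m| + |p * (1 - m ^ 2)| := abs_add_le _ _
    _ ≤ T + p := by linarith

lemma abs_tan_le_tan {θ a : ℝ} (hθ : |θ| ≤ a) (ha : a < π / 2) : |Real.tan θ| ≤ Real.tan a := by
  have hmono := Real.strictMonoOn_tan.monotoneOn
  obtain ⟨h1, h2⟩ := abs_le.1 hθ
  have hlo : -(π / 2) < -a := by linarith
  have hmem : a ∈ Ioo (-(π / 2)) (π / 2) := ⟨by linarith, ha⟩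
  have hθmem : θ ∈ Ioo (-(π / 2)) (π / 2) := ⟨by linarith, by linarith⟩
  have hneg : -a ∈ Ioo (-(π / 2)) (π / 2) := ⟨hlo, by linarith⟩
  refine abs_le.2 ⟨?_, hmono hθmem hmem h2⟩
  rw [← Real.tan_neg]
  exact hmono hneg hθmem h1

/-- Bound on the nonsingular boundary-interaction term `A9` in the
evolution of the maximum of the slope.  Let `0 < ε < 1/10`, let `g` be `C¹` with
`‖g‖_{L^∞} < π/4` and `0 < ∂_x g(x0) ≤ 1`.  Writing `θ̄ = (g(x0) + g(η))/2`,
`s = (x0 - η)/2`, `μ2 = tan θ̄ tanh s`, the integral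
`A9 = ∫ (-∂_x g(x0) μ2² + ((∂_x g(x0))² - 1) μ2 + ∂_x g(x0))
      / (cosh²s cos²θ̄ (1 + tan²θ̄ tanh²s / |tanh s|^{2ε})²) dη`
satisfies `|A9| ≤ 4 sec²(‖g‖_{L^∞}) (tan(‖g‖_{L^∞}) + ∂_x g(x0))`. -/
theorem boundary_slope_term_bound
    (ε : ℝ) (hε : 0 < ε) (hε' : ε < 1 / 10)
    (g : ℝ → ℝ) (hg : ContDiff ℝ 1 g)
    (a : ℝ) (ha : IsLUB (Set.range fun x => |g x|) a) (haπ : a < π / 4)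
    (x0 : ℝ) (hpos : 0 < deriv g x0) (hle1 : deriv g x0 ≤ 1) :
    |∫ η : ℝ,
        (-(deriv g x0) * (Real.tan ((g x0 + g η) / 2) * Real.tanh ((x0 - η) / 2)) ^ 2
          + ((deriv g x0) ^ 2 - 1)
              * (Real.tan ((g x0 + g η) / 2) * Real.tanh ((x0 - η) / 2))
          + deriv g x0)
        / (Real.cosh ((x0 - η) / 2) ^ 2 * Real.cos ((g x0 + g η) / 2) ^ 2
            * (1 + Real.tan ((g x0 + g η) / 2) ^ 2 * Real.tanh ((x0 - η) / 2) ^ 2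
                / |Real.tanh ((x0 - η) / 2)| ^ (2 * ε)) ^ 2)|
      ≤ 4 * (Real.cos a)⁻¹ ^ 2 * (Real.tan a + deriv g x0) := by
  have hga : ∀ x, |g x| ≤ a := fun x => ha.1 (mem_range_self x)
  have ha0 : 0 ≤ a := (abs_nonneg _).trans (hga x0)
  have hcosa : 0 < Real.cos a := Real.cos_pos_of_mem_Ioo ⟨by linarith [Real.pi_pos], by linarith⟩
  have htana : Real.tan a ≤ 1 := by
    rw [← Real.tan_pi_div_four]
    exact Real.strictMonoOn_tan.monotoneOn ⟨by linarith [Real.pi_pos], by linarith⟩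
      ⟨by linarith [Real.pi_pos], by linarith [Real.pi_pos]⟩ haπ.le
  set C : ℝ := (Real.cos a)⁻¹ ^ 2 * (Real.tan a + deriv g x0) with hC
  have hint : Integrable fun η : ℝ => (Real.cosh ((x0 - η) / 2) ^ 2)⁻¹ :=
    (integrable_inv_cosh_sq.comp_div two_ne_zero).comp_sub_left x0
  have hval : ∫ η : ℝ, (Real.cosh ((x0 - η) / 2) ^ 2)⁻¹ = 4 := by
    rw [integral_sub_left_eq_self (fun y : ℝ => (Real.cosh (y / 2) ^ 2)⁻¹) volume x0,
      Measure.integral_comp_div (fun y : ℝ => (Real.cosh y ^ 2)⁻¹), integral_inv_cosh_sq]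
    norm_num
  have hbound : 4 * (Real.cos a)⁻¹ ^ 2 * (Real.tan a + deriv g x0)
      = ∫ η : ℝ, C * (Real.cosh ((x0 - η) / 2) ^ 2)⁻¹ := by
    rw [integral_const_mul, hval, hC]
    ring
  rw [hbound, ← Real.norm_eq_abs]
  refine norm_integral_le_of_norm_le (hint.const_mul C) (Filter.Eventually.of_forall fun η => ?_)
  set θ := (g x0 + g η) / 2
  set s := (x0 - η) / 2
  have hθ : |θ| ≤ a := by
    have h1 := abs_le.1 (hga x0)
    have h2 := abs_le.1 (hga η)
    exact abs_le.2 ⟨by simp only [θ]; linarith, by simp only [θ]; linarith⟩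
  have hμ : |Real.tan θ * Real.tanh s| ≤ Real.tan a := by
    rw [abs_mul]
    have htanh : |Real.tanh s| ≤ 1 :=
      abs_le.2 ⟨(Real.neg_one_lt_tanh s).le, (Real.tanh_lt_one s).le⟩
    exact (mul_le_of_le_one_right (abs_nonneg _) htanh).trans
      (abs_tan_le_tan hθ (by linarith))
  have hnum := abs_slope_numerator_le hpos.le hle1 hμ htana
  have hcosθ : Real.cos a ≤ Real.cos θ := by
    rw [← Real.cos_abs θ]
    exact Real.cos_le_cos_of_nonneg_of_le_pi (abs_nonneg _) (by linarith [Real.pi_pos]) hθ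
  have hcosh := Real.cosh_pos s
  have hreg : 1 ≤ (1 + Real.tan θ ^ 2 * Real.tanh s ^ 2 / |Real.tanh s| ^ (2 * ε)) ^ 2 :=
    one_le_pow₀ (le_add_of_nonneg_right (by positivity))
  have hden : Real.cosh s ^ 2 * Real.cos a ^ 2 ≤ Real.cosh s ^ 2 * Real.cos θ ^ 2
      * (1 + Real.tan θ ^ 2 * Real.tanh s ^ 2 / |Real.tanh s| ^ (2 * ε)) ^ 2 := by
    refine le_trans ?_ (le_mul_of_one_le_right (by positivity) hreg)
    gcongr
  have hden0 : 0 < Real.cosh s ^ 2 * Real.cos a ^ 2 := by positivity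
  rw [Real.norm_eq_abs, abs_div, abs_of_pos (hden0.trans_le hden)]
  calc _ ≤ (Real.tan a + deriv g x0) / (Real.cosh s ^ 2 * Real.cos a ^ 2) :=
        div_le_div₀ ((abs_nonneg _).trans hnum) hnum hden0 hden
    _ = C * (Real.cosh s ^ 2)⁻¹ := by
        rw [hC]
        field_simp
end
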